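/- Let μ₁ and μ₂ be Borel probability measures on ℝ with finite second moments, with cumulative distribution functions F₁, F₂ and quantile functions Q_i(z) = inf{x ∈ ℝ : F_i(x) ≥ z} for z ∈ (0,1). Then the 2-Wasserstein distance between μ₁ and μ₂ equals the L²(0,1) distance between their quantile functions: W₂(μ₁, μ₂) = (∫₀¹ |Q₁(z) − Q₂(z)|² dz)^{1/2}. -/

import Mathlib

open MeasureTheory Filter Set
open scoped ENNReal NNReal

noncomputable section

abbrev Rd (d : ℕ) := EuclideanSpace ℝ (Fin d)

/-- `π` is a coupling of `μ` and `ν`. -/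
def IsCoupling {α : Type*} [MeasurableSpace α] (π : Measure (α × α)) (μ ν : Measure α) : Prop :=
  π.map Prod.fst = μ ∧ π.map Prod.snd = ν

/-- Squared transport cost with ground cost `c`. -/
noncomputable def transportCost2 {α : Type*} [MeasurableSpace α] (c : α → α → ℝ≥0∞)
    (μ ν : Measure α) : ℝ≥0∞ :=
  ⨅ π ∈ {π : Measure (α × α) | IsCoupling π μ ν}, ∫⁻ q, c q.1 q.2 ^ 2 ∂π

/-- 2-Wasserstein distance with ground cost `c`. -/
noncomputable def wasserstein2 {α : Type*} [MeasurableSpace α] (c : α → α → ℝ≥0∞)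
    (μ ν : Measure α) : ℝ≥0∞ :=
  transportCost2 c μ ν ^ (1 / 2 : ℝ)

/-- The 2-Wasserstein distance on a normed measurable space. -/
noncomputable def W2 {α : Type*} [MeasurableSpace α] [EDist α] (μ ν : Measure α) : ℝ≥0∞ :=
  wasserstein2 (fun x y => edist x y) μ ν

/-- `μ ∈ P₂`: a Borel probability measure with finite second moment. -/
def MemP2 {α : Type*} [MeasurableSpace α] [NormedAddCommGroup α] (μ : Measure α) : Prop :=
  IsProbabilityMeasure μ ∧ ∫⁻ x, (‖x‖₊ : ℝ≥0∞) ^ 2 ∂μ < ⊤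
/-- The quantile (generalized inverse CDF) of a measure on `ℝ`:
`Q(z) = inf {x : F(x) ≥ z}` where `F(x) = μ((−∞, x])`. -/
noncomputable def quantileFn (μ : Measure ℝ) (z : ℝ) : ℝ :=
  sInf {x : ℝ | z ≤ (μ (Set.Iic x)).toReal}

section QuantileCoupling

open ProbabilityTheory

theorem quantileFn_eq_sInf_cdf (μ : Measure ℝ) [IsProbabilityMeasure μ] (z : ℝ) :
    quantileFn μ z = sInf {x : ℝ | z ≤ cdf μ x} := by
  simp only [quantileFn, cdf_eq_real, measureReal_def]

/-- The quantile function and the distribution function form a Galois connection on `(0, 1)`. -/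
theorem quantileFn_le_iff (μ : Measure ℝ) [IsProbabilityMeasure μ] {z : ℝ}
    (hz : z ∈ Ioo (0 : ℝ) 1) (x : ℝ) : quantileFn μ z ≤ x ↔ z ≤ cdf μ x := by
  rw [quantileFn_eq_sInf_cdf]
  have hne : {x : ℝ | z ≤ cdf μ x}.Nonempty := by
    obtain ⟨x, hx⟩ := ((tendsto_cdf_atTop μ).eventually (lt_mem_nhds hz.2)).exists
    exact ⟨x, hx.le⟩
  have hbdd : BddBelow {x : ℝ | z ≤ cdf μ x} := by
    obtain ⟨a, ha⟩ := ((tendsto_cdf_atBot μ).eventually (gt_mem_nhds hz.1)).exists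
    refine ⟨a, fun y hy => le_of_not_gt fun hya => ?_⟩
    exact absurd (le_trans hy (monotone_cdf μ hya.le)) (not_le.mpr ha)
  refine ⟨fun h => ?_, fun h => csInf_le hbdd h⟩
  have hright : Tendsto (cdf μ) (nhdsWithin x (Ioi x)) (nhds (cdf μ x)) :=
    ((cdf μ).right_continuous x).mono_left (nhdsWithin_mono _ Ioi_subset_Ici_self)
  refine ge_of_tendsto hright ?_
  filter_upwards [self_mem_nhdsWithin] with y hy
  obtain ⟨w, hw, hwy⟩ := exists_lt_of_csInf_lt hne (lt_of_le_of_lt h hy)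
  exact le_trans hw (monotone_cdf μ hwy.le)

theorem aemeasurable_quantileFn (μ : Measure ℝ) [IsProbabilityMeasure μ] :
    AEMeasurable (quantileFn μ) (volume.restrict (Ioo (0 : ℝ) 1)) := by
  refine aemeasurable_restrict_of_monotoneOn measurableSet_Ioo fun z hz w hw hzw => ?_
  rw [quantileFn_le_iff μ hz]
  exact hzw.trans ((quantileFn_le_iff μ hw _).1 le_rfl)

/-- The quantile function pushes the uniform law on `(0, 1)` forward to the measure. -/
theorem map_quantileFn (μ : Measure ℝ) [IsProbabilityMeasure μ] :
    (volume.restrict (Ioo (0 : ℝ) 1)).map (quantileFn μ) = μ := by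
  have : IsFiniteMeasure ((volume.restrict (Ioo (0 : ℝ) 1)).map (quantileFn μ)) :=
    Measure.isFiniteMeasure_map _ _
  refine Measure.ext_of_Iic _ _ fun x => ?_
  rw [Measure.map_apply_of_aemeasurable (aemeasurable_quantileFn μ) measurableSet_Iic,
    ← ofReal_cdf μ x, Measure.restrict_apply₀' measurableSet_Ioo.nullMeasurableSet]
  have hset : quantileFn μ ⁻¹' Iic x ∩ Ioo 0 1 = Iic (cdf μ x) ∩ Ioo 0 1 := by
    ext z
    simp only [mem_inter_iff, mem_preimage, mem_Iic]
    exact and_congr_left fun hz => quantileFn_le_iff μ hz x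
  rw [hset]
  have hae : (Iic (cdf μ x) ∩ Ioo 0 1 : Set ℝ) =ᵐ[volume] (Iic (cdf μ x) ∩ Ioc 0 1 : Set ℝ) :=
    (ae_eq_refl _).inter Ioo_ae_eq_Ioc
  rw [measure_congr hae, inter_comm, Ioc_inter_Iic, min_eq_right (cdf_le_one μ x),
    Real.volume_Ioc, sub_zero]

/-- The comonotone coupling of two measures on `ℝ`. -/
def quantileCoupling (μ ν : Measure ℝ) : Measure (ℝ × ℝ) :=
  (volume.restrict (Ioo (0 : ℝ) 1)).map fun z => (quantileFn μ z, quantileFn ν z)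

theorem isCoupling_quantileCoupling (μ ν : Measure ℝ) [IsProbabilityMeasure μ]
    [IsProbabilityMeasure ν] : IsCoupling (quantileCoupling μ ν) μ ν := by
  have h := (aemeasurable_quantileFn μ).prodMk (aemeasurable_quantileFn ν)
  constructor
  · rw [quantileCoupling, AEMeasurable.map_map_of_aemeasurable measurable_fst.aemeasurable h]
    exact map_quantileFn μ
  · rw [quantileCoupling, AEMeasurable.map_map_of_aemeasurable measurable_snd.aemeasurable h]
    exact map_quantileFn ν

theorem map_swap_quantileCoupling (μ ν : Measure ℝ) [IsProbabilityMeasure μ]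
    [IsProbabilityMeasure ν] : (quantileCoupling μ ν).map Prod.swap = quantileCoupling ν μ := by
  rw [quantileCoupling, AEMeasurable.map_map_of_aemeasurable measurable_swap.aemeasurable
    ((aemeasurable_quantileFn μ).prodMk (aemeasurable_quantileFn ν))]
  rfl

theorem IsCoupling.map_swap {α : Type*} [MeasurableSpace α] {π : Measure (α × α)}
    {μ ν : Measure α} (h : IsCoupling π μ ν) : IsCoupling (π.map Prod.swap) ν μ := by
  constructor
  · rw [Measure.map_map measurable_fst measurable_swap]
    exact h.2
  · rw [Measure.map_map measurable_snd measurable_swap]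
    exact h.1

theorem IsCoupling.isProbabilityMeasure {α : Type*} [MeasurableSpace α] {π : Measure (α × α)}
    {μ ν : Measure α} [IsProbabilityMeasure μ] (h : IsCoupling π μ ν) :
    IsProbabilityMeasure π := by
  refine ⟨?_⟩
  rw [← measure_univ (μ := μ), ← h.1, Measure.map_apply measurable_fst MeasurableSet.univ,
    preimage_univ]

/-- Among all couplings, the comonotone one gives the least mass to quadrants
`(-∞, s] × (t, ∞)`. -/
theorem quantileCoupling_Iic_prod_Ioi_le {π : Measure (ℝ × ℝ)} {μ ν : Measure ℝ}
    [IsProbabilityMeasure μ] [IsProbabilityMeasure ν] (h : IsCoupling π μ ν) (s t : ℝ) :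
    quantileCoupling μ ν (Iic s ×ˢ Ioi t) ≤ π (Iic s ×ˢ Ioi t) := by
  have hle : quantileCoupling μ ν (Iic s ×ˢ Ioi t) ≤ μ (Iic s) - ν (Iic t) := by
    rw [quantileCoupling, Measure.map_apply_of_aemeasurable
      ((aemeasurable_quantileFn μ).prodMk (aemeasurable_quantileFn ν))
      (measurableSet_Iic.prod measurableSet_Ioi),
      Measure.restrict_apply₀' measurableSet_Ioo.nullMeasurableSet, ← ofReal_cdf μ,
      ← ofReal_cdf ν, ← ENNReal.ofReal_sub _ (cdf_nonneg ν t), ← Real.volume_Ioc]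
    refine measure_mono ?_
    rintro z ⟨⟨hs, ht⟩, hz⟩
    refine ⟨not_le.1 fun hzt => ?_, (quantileFn_le_iff μ hz s).1 hs⟩
    exact absurd ((quantileFn_le_iff ν hz t).2 hzt) (not_le.2 ht)
  refine hle.trans (tsub_le_iff_right.2 ?_)
  rw [← h.1, ← h.2, Measure.map_apply measurable_fst measurableSet_Iic,
    Measure.map_apply measurable_snd measurableSet_Iic]
  refine (measure_mono ?_).trans (measure_union_le _ _)
  intro q hq
  by_cases hqt : q.2 ≤ t
  · exact Or.inr hqt
  · exact Or.inl ⟨hq, not_le.1 hqt⟩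

/-- The open-ended triangle `x ≤ s < t < y`. -/
def orderTriangle (x y : ℝ) : Set (ℝ × ℝ) := {p | x ≤ p.1 ∧ p.1 < p.2 ∧ p.2 < y}

theorem volume_orderTriangle_of_le {x y : ℝ} (h : x ≤ y) :
    volume (orderTriangle x y) = ENNReal.ofReal ((y - x) ^ 2 / 2) := by
  have hset : orderTriangle x y = regionBetween id (fun _ => y) (Icc x y) := by
    ext p
    simp only [orderTriangle, regionBetween, mem_ofPred_eq, mem_Icc, mem_Ioo, id]
    constructor
    · rintro ⟨h1, h2, h3⟩
      exact ⟨⟨h1, (h2.trans h3).le⟩, h2, h3⟩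
    · rintro ⟨⟨h1, _⟩, h2, h3⟩
      exact ⟨h1, h2, h3⟩
  rw [hset, Measure.volume_eq_prod, volume_regionBetween_eq_integral
    (continuous_id.integrableOn_Icc) (continuous_const.integrableOn_Icc) measurableSet_Icc
    (fun z hz => hz.2), integral_Icc_eq_integral_Ioc, ← intervalIntegral.integral_of_le h]
  congr 1
  simp only [Pi.sub_apply, id]
  rw [intervalIntegral.integral_sub (by simp) (by simp)]
  simp only [intervalIntegral.integral_const, integral_id, smul_eq_mul]
  ring

theorem orderTriangle_eq_empty {x y : ℝ} (h : y ≤ x) : orderTriangle x y = ∅ := by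
  refine eq_empty_of_forall_notMem fun p hp => ?_
  exact absurd (hp.1.trans_lt (hp.2.1.trans hp.2.2)) (not_lt.2 h)

theorem edist_sq_eq_volume_orderTriangle (x y : ℝ) :
    edist x y ^ 2 = 2 * (volume (orderTriangle x y) + volume (orderTriangle y x)) := by
  have key : ∀ a b : ℝ, a ≤ b →
      edist a b ^ 2 = 2 * (volume (orderTriangle a b) + volume (orderTriangle b a)) := by
    intro a b hab
    rw [orderTriangle_eq_empty hab, measure_empty, add_zero, volume_orderTriangle_of_le hab,
      edist_dist, Real.dist_eq, ← ENNReal.ofReal_pow (abs_nonneg _), sq_abs,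
      ← ENNReal.ofReal_ofNat 2, ← ENNReal.ofReal_mul (by norm_num)]
    congr 1
    ring
  rcases le_total x y with h | h
  · exact key x y h
  · rw [edist_comm, add_comm]
    exact key y x h

theorem measurableSet_orderTriangle_graph :
    MeasurableSet {r : (ℝ × ℝ) × (ℝ × ℝ) | r.2 ∈ orderTriangle r.1.1 r.1.2} := by
  simp only [orderTriangle, mem_ofPred_eq]
  measurability

theorem measurable_volume_orderTriangle :
    Measurable fun q : ℝ × ℝ => volume (orderTriangle q.1 q.2) :=
  measurable_measure_prodMk_left measurableSet_orderTriangle_graph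

theorem lintegral_volume_orderTriangle (π : Measure (ℝ × ℝ)) [SFinite π] :
    ∫⁻ q, volume (orderTriangle q.1 q.2) ∂π =
      ∫⁻ p : ℝ × ℝ, π {q | p ∈ orderTriangle q.1 q.2} :=
  (Measure.prod_apply (μ := π) (ν := volume) measurableSet_orderTriangle_graph).symm.trans
    (Measure.prod_apply_symm measurableSet_orderTriangle_graph)

theorem lintegral_volume_orderTriangle_quantileCoupling_le {π : Measure (ℝ × ℝ)}
    {μ ν : Measure ℝ} [IsProbabilityMeasure μ] [IsProbabilityMeasure ν]
    (h : IsCoupling π μ ν) :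
    ∫⁻ q, volume (orderTriangle q.1 q.2) ∂(quantileCoupling μ ν) ≤
      ∫⁻ q, volume (orderTriangle q.1 q.2) ∂π := by
  have := h.isProbabilityMeasure
  have := (isCoupling_quantileCoupling μ ν).isProbabilityMeasure
  rw [lintegral_volume_orderTriangle, lintegral_volume_orderTriangle]
  refine lintegral_mono fun p => ?_
  by_cases hp : p.1 < p.2
  · have hset : {q : ℝ × ℝ | p ∈ orderTriangle q.1 q.2} = Iic p.1 ×ˢ Ioi p.2 := by
      ext q
      simp [orderTriangle, hp]
    simp only [hset]
    exact quantileCoupling_Iic_prod_Ioi_le h p.1 p.2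
  · simp [orderTriangle, hp]

theorem lintegral_edist_sq_eq (π : Measure (ℝ × ℝ)) :
    ∫⁻ q, edist q.1 q.2 ^ 2 ∂π = 2 * (∫⁻ q, volume (orderTriangle q.1 q.2) ∂π +
      ∫⁻ q, volume (orderTriangle q.1 q.2) ∂(π.map Prod.swap)) := by
  rw [lintegral_map measurable_volume_orderTriangle measurable_swap,
    ← lintegral_add_left measurable_volume_orderTriangle,
    ← lintegral_const_mul' _ _ (by norm_num)]
  exact lintegral_congr fun q => edist_sq_eq_volume_orderTriangle q.1 q.2

/-- The comonotone coupling is optimal for the quadratic cost. -/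
theorem lintegral_edist_sq_quantileCoupling_le {π : Measure (ℝ × ℝ)} {μ ν : Measure ℝ}
    [IsProbabilityMeasure μ] [IsProbabilityMeasure ν] (h : IsCoupling π μ ν) :
    ∫⁻ q, edist q.1 q.2 ^ 2 ∂(quantileCoupling μ ν) ≤ ∫⁻ q, edist q.1 q.2 ^ 2 ∂π := by
  rw [lintegral_edist_sq_eq, lintegral_edist_sq_eq, map_swap_quantileCoupling]
  gcongr 2 * (?_ + ?_)
  · exact lintegral_volume_orderTriangle_quantileCoupling_le h
  · exact lintegral_volume_orderTriangle_quantileCoupling_le h.map_swap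

theorem transportCost2_edist_eq (μ ν : Measure ℝ) [IsProbabilityMeasure μ]
    [IsProbabilityMeasure ν] :
    transportCost2 (fun x y => edist x y) μ ν =
      ∫⁻ q, edist q.1 q.2 ^ 2 ∂(quantileCoupling μ ν) :=
  le_antisymm (iInf₂_le (quantileCoupling μ ν) (isCoupling_quantileCoupling μ ν))
    (le_iInf₂ fun _ hπ => lintegral_edist_sq_quantileCoupling_le hπ)

theorem lintegral_edist_sq_quantileCoupling (μ ν : Measure ℝ) [IsProbabilityMeasure μ]
    [IsProbabilityMeasure ν] :
    ∫⁻ q, edist q.1 q.2 ^ 2 ∂(quantileCoupling μ ν) =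
      ∫⁻ z in Ioo (0 : ℝ) 1, ENNReal.ofReal (|quantileFn μ z - quantileFn ν z| ^ 2) := by
  rw [quantileCoupling, lintegral_map' (by fun_prop)
    ((aemeasurable_quantileFn μ).prodMk (aemeasurable_quantileFn ν))]
  refine lintegral_congr fun z => ?_
  rw [edist_dist, Real.dist_eq, ENNReal.ofReal_pow (abs_nonneg _)]

end QuantileCoupling

/-- For probability measures on `ℝ` with finite second moments, the
2-Wasserstein distance equals the `L²(0,1)` distance between quantile functions:
`W₂(μ₁, μ₂) = (∫₀¹ |Q₁(z) − Q₂(z)|² dz)^{1/2}`. -/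
theorem wasserstein_eq_quantile_distance (μ₁ μ₂ : Measure ℝ)
    (h₁ : MemP2 μ₁) (h₂ : MemP2 μ₂) :
    W2 μ₁ μ₂ =
      (∫⁻ z in Set.Ioo (0 : ℝ) 1,
        ENNReal.ofReal (|quantileFn μ₁ z - quantileFn μ₂ z| ^ 2)) ^ (1 / 2 : ℝ) := by
  have := h₁.1
  have := h₂.1
  rw [W2, wasserstein2, transportCost2_edist_eq, lintegral_edist_sq_quantileCoupling]
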